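/- Fix s > 0. Let f : ℂ → ℂ be real-differentiable at every point with ∫_ℂ |f(z)|² dA(z) < ∞ (Lebesgue measure on ℂ ≅ ℝ²). If ∂̄f(z) + s·conj(z)·conj(f(z)) = 0 for all z ∈ ℂ, then f is identically zero. -/

import Mathlib

open MeasureTheory

/-- The Wirtinger derivative `∂̄g(z) = ½(Dg(z)(1) + i·Dg(z)(i))`. -/
noncomputable def wirtingerDBar (g : ℂ → ℂ) (z : ℂ) : ℂ :=
  (1 / 2 : ℂ) * (fderiv ℝ g z 1 + Complex.I * fderiv ℝ g z Complex.I)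

open Set Filter Topology

theorem wirtingerDBar_mul {g h : ℂ → ℂ} {z : ℂ} (hg : DifferentiableAt ℝ g z)
    (hh : DifferentiableAt ℝ h z) :
    wirtingerDBar (fun w => g w * h w) z = g z * wirtingerDBar h z + h z * wirtingerDBar g z := by
  simp only [wirtingerDBar, fderiv_fun_mul hg hh, add_apply, smul_apply, smul_eq_mul]
  ring

theorem wirtingerDBar_id (z : ℂ) : wirtingerDBar (fun w => w) z = 0 := by
  simp [wirtingerDBar]

/-- The closed square of side `2R` centred at the origin. -/
def centeredSquare (R : ℝ) : Set ℂ := Icc (-R) R ×ℂ Icc (-R) R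

theorem mem_centeredSquare {R : ℝ} {z : ℂ} :
    z ∈ centeredSquare R ↔ |z.re| ≤ R ∧ |z.im| ≤ R := by
  simp [centeredSquare, Complex.mem_reProdIm, abs_le]

theorem isCompact_centeredSquare (R : ℝ) : IsCompact (centeredSquare R) :=
  isCompact_Icc.reProdIm isCompact_Icc

theorem measurableSet_centeredSquare (R : ℝ) : MeasurableSet (centeredSquare R) :=
  (isCompact_centeredSquare R).measurableSet

theorem setIntegral_centeredSquare {g : ℂ → ℂ} (hg : Continuous g) {R : ℝ} (hR : 0 ≤ R) :
    ∫ z in centeredSquare R, g z =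
      ∫ x : ℝ in (-R)..R, ∫ y : ℝ in (-R)..R, g (x + y * Complex.I) := by
  have hR' : -R ≤ R := by linarith
  have hpre : Complex.measurableEquivRealProd.symm ⁻¹' centeredSquare R =
      Icc (-R) R ×ˢ Icc (-R) R := rfl
  have hcont : Continuous fun p : ℝ × ℝ => g (Complex.measurableEquivRealProd.symm p) :=
    hg.comp Complex.equivRealProdCLM.symm.continuous
  rw [← Complex.volume_preserving_equiv_real_prod.symm.setIntegral_preimage_emb
    Complex.measurableEquivRealProd.symm.measurableEmbedding, hpre, Measure.volume_eq_prod,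
    setIntegral_prod _ (hcont.continuousOn.integrableOn_compact (isCompact_Icc.prod isCompact_Icc))]
  simp only [intervalIntegral.integral_of_le hR', integral_Icc_eq_integral_Ioc,
    Complex.measurableEquivRealProd_symm_apply, Complex.mk_eq_add_mul_I]

/-- Green's theorem on a square for a function vanishing on the boundary; only continuity of
`∂̄g` is required. -/
theorem setIntegral_wirtingerDBar_eq_zero {g : ℂ → ℂ} (hg : Differentiable ℝ g)
    (hcont : Continuous (wirtingerDBar g)) {R : ℝ} (hR : 0 ≤ R)
    (hre : ∀ z : ℂ, |z.re| = R → g z = 0) (him : ∀ z : ℂ, |z.im| = R → g z = 0) :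
    ∫ z in centeredSquare R, wirtingerDBar g z = 0 := by
  have hform : ∀ z, Complex.I • fderiv ℝ g z 1 - fderiv ℝ g z Complex.I =
      2 * Complex.I * wirtingerDBar g z := by
    intro z
    simp only [wirtingerDBar, smul_eq_mul]
    linear_combination -(fderiv ℝ g z Complex.I) * Complex.I_sq
  have green := Complex.integral_boundary_rect_of_differentiableOn_real g ⟨-R, -R⟩ ⟨R, R⟩
    hg.differentiableOn (by
      simp only [hform]
      exact (hcont.const_mul _).continuousOn.integrableOn_compact
        (isCompact_uIcc.reProdIm isCompact_uIcc))
  have hbot : ∀ x : ℝ, g (x + (-R : ℝ) * Complex.I) = 0 := fun x =>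
    him _ (by simp [abs_of_nonneg hR])
  have htop : ∀ x : ℝ, g (x + R * Complex.I) = 0 := fun x =>
    him _ (by simp [abs_of_nonneg hR])
  have hleft : ∀ y : ℝ, g ((-R : ℝ) + y * Complex.I) = 0 := fun y =>
    hre _ (by simp [abs_of_nonneg hR])
  have hright : ∀ y : ℝ, g (R + y * Complex.I) = 0 := fun y =>
    hre _ (by simp [abs_of_nonneg hR])
  simp only [hform, hbot, htop, hleft, hright, intervalIntegral.integral_zero, smul_zero, sub_zero,
    add_zero] at green
  rw [← setIntegral_centeredSquare (hcont.const_mul (2 * Complex.I)) hR,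
    integral_const_mul] at green
  simpa using green.symm

/-- A polynomial cutoff vanishing on the boundary of `centeredSquare R`. -/
def squareCutoff (R : ℝ) (z : ℂ) : ℝ := (R ^ 2 - z.re ^ 2) * (R ^ 2 - z.im ^ 2)

theorem continuous_squareCutoff (R : ℝ) : Continuous (squareCutoff R) := by
  unfold squareCutoff
  fun_prop

theorem hasFDerivAt_squareCutoff (R : ℝ) (z : ℂ) :
    HasFDerivAt (fun w => (squareCutoff R w : ℂ))
      (Complex.ofRealCLM.comp ((R ^ 2 - z.re ^ 2) • (-((2 * z.im) • Complex.imCLM)) +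
        (R ^ 2 - z.im ^ 2) • (-((2 * z.re) • Complex.reCLM)))) z := by
  have hre : HasFDerivAt (fun w : ℂ => R ^ 2 - w.re ^ 2) (-((2 * z.re) • Complex.reCLM)) z := by
    simpa using (Complex.reCLM.hasFDerivAt (x := z)).pow 2 |>.const_sub (R ^ 2)
  have him : HasFDerivAt (fun w : ℂ => R ^ 2 - w.im ^ 2) (-((2 * z.im) • Complex.imCLM)) z := by
    simpa using (Complex.imCLM.hasFDerivAt (x := z)).pow 2 |>.const_sub (R ^ 2)
  exact Complex.ofRealCLM.hasFDerivAt.comp z (hre.mul him)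

theorem wirtingerDBar_squareCutoff (R : ℝ) (z : ℂ) :
    wirtingerDBar (fun w => (squareCutoff R w : ℂ)) z =
      -((z.re * (R ^ 2 - z.im ^ 2) : ℝ) + (z.im * (R ^ 2 - z.re ^ 2) : ℝ) * Complex.I) := by
  rw [wirtingerDBar, (hasFDerivAt_squareCutoff R z).fderiv]
  simp
  ring

theorem norm_wirtingerDBar_squareCutoff_le {R : ℝ} {z : ℂ} (hz : z ∈ centeredSquare R) :
    ‖wirtingerDBar (fun w => (squareCutoff R w : ℂ)) z‖ ≤ R ^ 2 * ‖z‖ := by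
  obtain ⟨hx, hy⟩ := mem_centeredSquare.1 hz
  have hx2 : z.re ^ 2 ≤ R ^ 2 :=
    sq_le_sq' (by linarith [neg_abs_le z.re]) ((le_abs_self _).trans hx)
  have hy2 : z.im ^ 2 ≤ R ^ 2 :=
    sq_le_sq' (by linarith [neg_abs_le z.im]) ((le_abs_self _).trans hy)
  rw [wirtingerDBar_squareCutoff, norm_neg]
  refine abs_le_of_sq_le_sq' ?_ (by positivity) |>.2
  rw [mul_pow, Complex.sq_norm, Complex.sq_norm, Complex.normSq_add_mul_I, Complex.normSq_apply]
  have h1 : (R ^ 2 - z.im ^ 2) ^ 2 ≤ (R ^ 2) ^ 2 :=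
    pow_le_pow_left₀ (by linarith) (by linarith [sq_nonneg z.im]) 2
  have h2 : (R ^ 2 - z.re ^ 2) ^ 2 ≤ (R ^ 2) ^ 2 :=
    pow_le_pow_left₀ (by linarith) (by linarith [sq_nonneg z.re]) 2
  nlinarith [mul_le_mul_of_nonneg_left h1 (sq_nonneg z.re),
    mul_le_mul_of_nonneg_left h2 (sq_nonneg z.im)]

section Equation

variable {s : ℝ} {f : ℂ → ℂ}

theorem wirtingerDBar_id_mul_sq_mul_squareCutoff (hf : Differentiable ℝ f)
    (heq : ∀ z, wirtingerDBar f z + (s : ℂ) * starRingEnd ℂ z * starRingEnd ℂ (f z) = 0)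
    (R : ℝ) (z : ℂ) :
    wirtingerDBar (fun w => w * (f w * f w * (squareCutoff R w : ℂ))) z =
      z * (f z * f z) * wirtingerDBar (fun w => (squareCutoff R w : ℂ)) z -
        ((2 * s * (squareCutoff R z * (‖z‖ ^ 2 * ‖f z‖ ^ 2)) : ℝ) : ℂ) := by
  have hη := (hasFDerivAt_squareCutoff R z).differentiableAt
  have hff : DifferentiableAt ℝ (fun w => f w * f w) z := (hf z).mul (hf z)
  have hffη : DifferentiableAt ℝ (fun w => f w * f w * (squareCutoff R w : ℂ)) z := hff.mul hη
  rw [wirtingerDBar_mul (g := fun w => w) differentiableAt_id hffη, wirtingerDBar_mul hff hη,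
    wirtingerDBar_mul (hf z) (hf z), wirtingerDBar_id, eq_neg_of_add_eq_zero_left (heq z)]
  push_cast
  rw [← Complex.mul_conj' z, ← Complex.mul_conj' (f z)]
  ring

theorem setIntegral_squareCutoff_le (hf : Differentiable ℝ f)
    (heq : ∀ z, wirtingerDBar f z + (s : ℂ) * starRingEnd ℂ z * starRingEnd ℂ (f z) = 0)
    {R : ℝ} (hR : 0 ≤ R) :
    2 * s * ∫ z in centeredSquare R, squareCutoff R z * (‖z‖ ^ 2 * ‖f z‖ ^ 2) ≤
      R ^ 2 * ∫ z in centeredSquare R, ‖z‖ ^ 2 * ‖f z‖ ^ 2 := by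
  have hfc := hf.continuous
  have hηc := continuous_squareCutoff R
  have hdη : Continuous (wirtingerDBar fun w => (squareCutoff R w : ℂ)) := by
    simp only [funext (wirtingerDBar_squareCutoff R)]
    fun_prop
  have hA : Continuous fun z =>
      z * (f z * f z) * wirtingerDBar (fun w => (squareCutoff R w : ℂ)) z := by fun_prop
  have hB : Continuous fun z => 2 * s * (squareCutoff R z * (‖z‖ ^ 2 * ‖f z‖ ^ 2)) := by fun_prop
  have hB' : Continuous fun z =>
      ((2 * s * (squareCutoff R z * (‖z‖ ^ 2 * ‖f z‖ ^ 2)) : ℝ) : ℂ) :=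
    Complex.continuous_ofReal.comp hB
  have hint {E : Type} [NormedAddCommGroup E] {g : ℂ → E} (hg : Continuous g) :
      IntegrableOn g (centeredSquare R) :=
    hg.continuousOn.integrableOn_compact (isCompact_centeredSquare R)
  have green := setIntegral_wirtingerDBar_eq_zero
    (g := fun w => w * (f w * f w * (squareCutoff R w : ℂ)))
    (differentiable_id.mul ((hf.mul hf).mul
      fun z => (hasFDerivAt_squareCutoff R z).differentiableAt))
    (by
      rw [funext (wirtingerDBar_id_mul_sq_mul_squareCutoff hf heq R)]
      exact hA.sub hB')
    hR
    (fun z hz => by simp [squareCutoff, ← hz])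
    (fun z hz => by simp [squareCutoff, ← hz])
  simp only [wirtingerDBar_id_mul_sq_mul_squareCutoff hf heq R] at green
  rw [integral_sub (hint hA) (hint hB'), integral_complex_ofReal,
    sub_eq_zero] at green
  rw [← integral_const_mul, ← integral_const_mul]
  calc ∫ z in centeredSquare R, 2 * s * (squareCutoff R z * (‖z‖ ^ 2 * ‖f z‖ ^ 2))
      ≤ ‖((∫ z in centeredSquare R,
          2 * s * (squareCutoff R z * (‖z‖ ^ 2 * ‖f z‖ ^ 2)) : ℝ) : ℂ)‖ := by
        rw [Complex.norm_real]
        exact Real.le_norm_self _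
    _ ≤ ∫ z in centeredSquare R, R ^ 2 * (‖z‖ ^ 2 * ‖f z‖ ^ 2) := by
        rw [← green]
        refine norm_integral_le_of_norm_le (hint (by fun_prop)) ?_
        filter_upwards [ae_restrict_mem (measurableSet_centeredSquare R)] with z hz
        calc ‖z * (f z * f z) * wirtingerDBar (fun w => (squareCutoff R w : ℂ)) z‖
            = ‖z‖ * ‖f z‖ ^ 2 * ‖wirtingerDBar (fun w => (squareCutoff R w : ℂ)) z‖ := by
              simp only [norm_mul]; ring
          _ ≤ ‖z‖ * ‖f z‖ ^ 2 * (R ^ 2 * ‖z‖) := by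
              gcongr
              exact norm_wirtingerDBar_squareCutoff_le hz
          _ = R ^ 2 * (‖z‖ ^ 2 * ‖f z‖ ^ 2) := by ring

theorem setIntegral_centeredSquare_le (hs : 0 < s) (hf : Differentiable ℝ f)
    (heq : ∀ z, wirtingerDBar f z + (s : ℂ) * starRingEnd ℂ z * starRingEnd ℂ (f z) = 0)
    {r R : ℝ} (hR : 0 < R) (hrR : 2 * r ≤ R) :
    s * ∫ z in centeredSquare r, ‖z‖ ^ 2 * ‖f z‖ ^ 2 ≤
      ∫ z in centeredSquare R, ‖z‖ ^ 2 / R ^ 2 * ‖f z‖ ^ 2 := by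
  have hfc := hf.continuous
  have hηc := continuous_squareCutoff R
  have hint {g : ℂ → ℝ} (hg : Continuous g) (ρ : ℝ) : IntegrableOn g (centeredSquare ρ) :=
    hg.continuousOn.integrableOn_compact (isCompact_centeredSquare ρ)
  have hcut : ∀ z ∈ centeredSquare R, 0 ≤ squareCutoff R z := by
    intro z hz
    obtain ⟨hx, hy⟩ := mem_centeredSquare.1 hz
    exact mul_nonneg (sub_nonneg.2 (sq_le_sq.2 (hx.trans (le_abs_self R))))
      (sub_nonneg.2 (sq_le_sq.2 (hy.trans (le_abs_self R))))
  have hcut' : ∀ z ∈ centeredSquare r, R ^ 4 / 2 ≤ squareCutoff R z := by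
    intro z hz
    obtain ⟨hx, hy⟩ := mem_centeredSquare.1 hz
    have hx2 : z.re ^ 2 ≤ (R / 2) ^ 2 := sq_le_sq.2 (by rw [abs_of_pos (half_pos hR)]; linarith)
    have hy2 : z.im ^ 2 ≤ (R / 2) ^ 2 := sq_le_sq.2 (by rw [abs_of_pos (half_pos hR)]; linarith)
    have hprod : (3 / 4 * R ^ 2) * (3 / 4 * R ^ 2) ≤ squareCutoff R z :=
      mul_le_mul (by linarith) (by linarith) (by positivity) (by nlinarith)
    nlinarith [pow_pos hR 4]
  have hsub : centeredSquare r ⊆ centeredSquare R := by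
    intro z hz
    obtain ⟨hx, hy⟩ := mem_centeredSquare.1 hz
    exact mem_centeredSquare.2 ⟨by linarith [abs_nonneg z.re], by linarith [abs_nonneg z.im]⟩
  have hlow : R ^ 4 / 2 * ∫ z in centeredSquare r, ‖z‖ ^ 2 * ‖f z‖ ^ 2 ≤
      ∫ z in centeredSquare R, squareCutoff R z * (‖z‖ ^ 2 * ‖f z‖ ^ 2) := by
    rw [← integral_const_mul]
    calc _ ≤ ∫ z in centeredSquare r, squareCutoff R z * (‖z‖ ^ 2 * ‖f z‖ ^ 2) :=
          setIntegral_mono_on (hint (by fun_prop) r) (hint (by fun_prop) r)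
            (measurableSet_centeredSquare r) fun z hz =>
              mul_le_mul_of_nonneg_right (hcut' z hz) (by positivity)
      _ ≤ _ := by
          refine setIntegral_mono_set (hint (by fun_prop) R) ?_ hsub.eventuallyLE
          filter_upwards [ae_restrict_mem (measurableSet_centeredSquare R)] with z hz
          exact mul_nonneg (hcut z hz) (by positivity)
  have hdiv : ∫ z in centeredSquare R, ‖z‖ ^ 2 / R ^ 2 * ‖f z‖ ^ 2 =
      (∫ z in centeredSquare R, ‖z‖ ^ 2 * ‖f z‖ ^ 2) / R ^ 2 := by
    rw [← integral_div]
    congr! 2 with z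
    ring
  have hmain := setIntegral_squareCutoff_le hf heq hR.le
  rw [hdiv, le_div_iff₀ (by positivity)]
  refine le_of_mul_le_mul_left ?_ (pow_pos hR 2)
  linarith [mul_le_mul_of_nonneg_left hlow (by positivity : 0 ≤ 2 * s)]

end Equation

theorem tendsto_setIntegral_centeredSquare_div_sq {f : ℂ → ℂ} (hf : Continuous f)
    (hL2 : Integrable fun z => ‖f z‖ ^ 2) :
    Tendsto (fun n : ℕ => ∫ z in centeredSquare n, ‖z‖ ^ 2 / (n : ℝ) ^ 2 * ‖f z‖ ^ 2)
      atTop (𝓝 0) := by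
  simp only [← integral_indicator (measurableSet_centeredSquare _)]
  rw [← integral_zero ℂ ℝ]
  refine tendsto_integral_of_dominated_convergence (fun z => 2 * ‖f z‖ ^ 2) (fun n => ?_)
    (hL2.const_mul 2) (fun n => ae_of_all _ fun z => ?_) (ae_of_all _ fun z => ?_)
  · exact (Continuous.aestronglyMeasurable (by fun_prop)).indicator (measurableSet_centeredSquare _)
  · by_cases hz : z ∈ centeredSquare n
    · rw [indicator_of_mem hz, Real.norm_of_nonneg (by positivity)]
      gcongr
      obtain ⟨hx, hy⟩ := mem_centeredSquare.1 hz
      refine div_le_of_le_mul₀ (by positivity) (by norm_num) ?_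
      rw [Complex.sq_norm, Complex.normSq_apply]
      nlinarith [sq_le_sq' (by linarith [neg_abs_le z.re]) ((le_abs_self _).trans hx),
        sq_le_sq' (by linarith [neg_abs_le z.im]) ((le_abs_self _).trans hy)]
    · rw [indicator_of_notMem hz, norm_zero]
      positivity
  · have hlim : Tendsto (fun n : ℕ => ‖z‖ ^ 2 / (n : ℝ) ^ 2 * ‖f z‖ ^ 2) atTop (𝓝 0) := by
      simpa using (((tendsto_pow_atTop two_ne_zero).comp
        tendsto_natCast_atTop_atTop).const_div_atTop (‖z‖ ^ 2)).mul_const (‖f z‖ ^ 2)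
    exact squeeze_zero (fun n => indicator_nonneg (fun w _ => by positivity) z)
      (fun n => indicator_le_self' (fun w _ => by positivity) z) hlim

/-- Example 1 of the paper: the equation `∂̄f + s·z̄·f̄ = 0` has only trivial
L² solutions. -/
theorem stmt8 (s : ℝ) (hs : 0 < s) (f : ℂ → ℂ)
    (hf : ∀ z : ℂ, DifferentiableAt ℝ f z)
    (hL2 : Integrable (fun z : ℂ => ‖f z‖ ^ 2))
    (heq : ∀ z : ℂ, wirtingerDBar f z
      + (s : ℂ) * (starRingEnd ℂ) z * (starRingEnd ℂ) (f z) = 0) :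
    ∀ z : ℂ, f z = 0 := by
  have hdf : Differentiable ℝ f := hf
  have hfc := hdf.continuous
  have hzero : ∀ r : ℝ, ∫ z in centeredSquare r, ‖z‖ ^ 2 * ‖f z‖ ^ 2 = 0 := by
    intro r
    have hle : s * ∫ z in centeredSquare r, ‖z‖ ^ 2 * ‖f z‖ ^ 2 ≤ 0 := by
      refine ge_of_tendsto (tendsto_setIntegral_centeredSquare_div_sq hfc hL2) ?_
      filter_upwards [eventually_gt_atTop 0,
        tendsto_natCast_atTop_atTop.eventually_ge_atTop (2 * r)] with n hn hrn
      exact setIntegral_centeredSquare_le hs hdf heq (Nat.cast_pos.2 hn) hrn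
    exact le_antisymm (nonpos_of_mul_nonpos_right hle hs) (integral_nonneg fun z => by positivity)
  have hcover : ⋃ n : ℕ, centeredSquare n = univ := by
    refine eq_univ_of_forall fun z => ?_
    obtain ⟨n, hn⟩ := exists_nat_ge ‖z‖
    exact mem_iUnion.2 ⟨n, mem_centeredSquare.2
      ⟨(Complex.abs_re_le_norm z).trans hn, (Complex.abs_im_le_norm z).trans hn⟩⟩
  have hae : ∀ᵐ z : ℂ, ‖z‖ ^ 2 * ‖f z‖ ^ 2 = 0 := by
    rw [← Measure.restrict_univ (μ := (volume : Measure ℂ)), ← hcover, ae_restrict_iUnion_iff]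
    intro n
    exact (setIntegral_eq_zero_iff_of_nonneg_ae (ae_of_all _ fun z => by positivity)
      ((by fun_prop : Continuous fun z => ‖z‖ ^ 2 * ‖f z‖ ^ 2).continuousOn.integrableOn_compact
        (isCompact_centeredSquare n))).1 (hzero n)
  have hf0 : f =ᵐ[volume] fun _ => 0 := by
    filter_upwards [hae, Measure.ae_ne volume 0] with z hz hz0
    simpa [hz0] using hz
  exact congrFun ((hfc.ae_eq_iff_eq volume continuous_const).1 hf0)
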